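/- No improvement from amplification for cutoff n = 1 in the NHPA receiver (Appendix claim, Eqs. (psuccn1)–(psuccn12)): For α > 0, β ∈ ℝ and g ≥ 1, define the real number P(α, β, g) = ½ [ 1 − e^{−4α² − β²} ( e^{4αβ} + 2(1 − g^{−1})(1 − e^{2αβ}) ) + e^{−β²} ]. Then for all α > 0, all β ∈ ℝ and all g ≥ 1, P(α, β, g) ≤ P(α, −|β|, 1); that is, the maximum of P over the displacement β and the gain g ≥ 1 is always achieved at g = 1 with nonpositive β. -/

import Mathlib

/-- Success probability of the NHPA receiver with cutoff `n = 1`, gain `g`, final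
displacement `−β`, and binary coherent signals of amplitude `±α`. -/
noncomputable def nhpaSucc (α β g : ℝ) : ℝ :=
  (1 / 2) * (1 - Real.exp (-4 * α ^ 2 - β ^ 2) *
      (Real.exp (4 * α * β) + 2 * (1 - g⁻¹) * (1 - Real.exp (2 * α * β)))
    + Real.exp (-β ^ 2))

/-- The bracket in `nhpaSucc`, with `x = exp (2αβ)` and `c = 1 - g⁻¹`, is smallest without gain. -/
lemma exp_neg_abs_sq_le {t c : ℝ} (hc₀ : 0 ≤ c) (hc₁ : c ≤ 1) :
    Real.exp (-|t|) ^ 2 ≤ Real.exp t ^ 2 + 2 * c * (1 - Real.exp t) := by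
  rcases le_total 0 t with ht | ht
  · have hx : 1 ≤ Real.exp t := Real.one_le_exp ht
    have hs : Real.exp (-|t|) ^ 2 ≤ 1 :=
      pow_le_one₀ (Real.exp_pos _).le (Real.exp_le_one_iff.2 (neg_nonpos.2 (abs_nonneg t)))
    nlinarith [sq_nonneg (Real.exp t - 1),
      mul_nonneg (sub_nonneg.2 hc₁) (sub_nonneg.2 hx)]
  · have hx : Real.exp t ≤ 1 := Real.exp_le_one_iff.2 ht
    rw [abs_of_nonpos ht, neg_neg]
    nlinarith [mul_nonneg hc₀ (sub_nonneg.2 hx)]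

/-- No improvement from amplification for cutoff `n = 1` in the NHPA receiver. -/
theorem nhpa_no_improvement_cutoff_one :
    ∀ α β g : ℝ, 0 < α → 1 ≤ g → nhpaSucc α β g ≤ nhpaSucc α (-|β|) 1 := by
  intro α β g hα hg
  have hc₀ : 0 ≤ 1 - g⁻¹ := sub_nonneg.2 (inv_le_one_of_one_le₀ hg)
  have hc₁ : 1 - g⁻¹ ≤ 1 := sub_le_self _ (inv_nonneg.2 (zero_le_one.trans hg))
  have key := exp_neg_abs_sq_le (t := 2 * α * β) hc₀ hc₁
  have habs : |2 * α * β| = 2 * α * |β| := by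
    rw [abs_mul, abs_of_pos (by positivity : 0 < 2 * α)]
  have hsq : ∀ u : ℝ, Real.exp (4 * α * u) = Real.exp (2 * α * u) ^ 2 := fun u => by
    rw [← Real.exp_nat_mul]
    congr 1
    push_cast
    ring
  rw [habs, ← mul_neg] at key
  have h := mul_le_mul_of_nonneg_left key (Real.exp_pos (-4 * α ^ 2 - β ^ 2)).le
  simp only [nhpaSucc, hsq, neg_sq, sq_abs, inv_one, sub_self, mul_zero, zero_mul, add_zero]
  linarith
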